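/- arXiv:1004.2445 — 4 statements merged into one kernel-verified Lean document; each statement's English description precedes it below -/
import Mathlib

section
/- For all real numbers a > 0 and b > 0, ∫₀^∞ exp(−a·x² − b/x²) dx = (1/2) · √(π/a) · exp(−2·√(a·b)). -/
open MeasureTheory

/-- The map `x ↦ s * x - c / x` sends the positive half-line onto the real line. -/
lemma image_mul_sub_div_Ioi {s c : ℝ} (hs : 0 < s) (hc : 0 < c) :
    (fun x : ℝ => s * x - c / x) '' Set.Ioi 0 = Set.univ := by
  refine Set.eq_univ_of_forall fun u => ?_
  have hr : |u| < √(u ^ 2 + 4 * s * c) := by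
    rw [← Real.sqrt_sq_eq_abs]
    exact Real.sqrt_lt_sqrt (sq_nonneg u) (by nlinarith [mul_pos hs hc])
  have hsq : √(u ^ 2 + 4 * s * c) ^ 2 = u ^ 2 + 4 * s * c := Real.sq_sqrt (by positivity)
  have hpos : 0 < u + √(u ^ 2 + 4 * s * c) := by linarith [neg_abs_le u]
  refine ⟨(u + √(u ^ 2 + 4 * s * c)) / (2 * s), div_pos hpos (by positivity), ?_⟩
  generalize √(u ^ 2 + 4 * s * c) = r at *
  have := hpos.ne'
  field_simp
  linear_combination hsq

lemma injOn_mul_sub_div_Ioi {s c : ℝ} (hs : 0 < s) (hc : 0 < c) :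
    Set.InjOn (fun x : ℝ => s * x - c / x) (Set.Ioi 0) := by
  refine StrictMonoOn.injOn fun x (hx : 0 < x) y _ hxy => ?_
  have h₁ : s * x < s * y := by gcongr
  have h₂ : c / y < c / x := by gcongr
  linarith

lemma hasDerivAt_const_div (k : ℝ) {x : ℝ} (hx : x ≠ 0) :
    HasDerivAt (fun x : ℝ => k / x) (-(k / x ^ 2)) x := by
  simpa [div_eq_mul_inv] using (hasDerivAt_inv hx).const_mul k

lemma hasDerivAt_mul_sub_div (s c : ℝ) {x : ℝ} (hx : x ≠ 0) :
    HasDerivAt (fun x : ℝ => s * x - c / x) (s + c / x ^ 2) x := by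
  simpa using ((hasDerivAt_id x).const_mul s).fun_sub (hasDerivAt_const_div c hx)

lemma integrableOn_mul_exp_neg_sq_mul_sub_div {s c : ℝ} (hs : 0 < s) (hc : 0 < c) :
    IntegrableOn (fun x : ℝ => (s + c / x ^ 2) * Real.exp (-(s * x - c / x) ^ 2)) (Set.Ioi 0) := by
  have h := integrableOn_image_iff_integrableOn_abs_deriv_smul measurableSet_Ioi
    (fun x (hx : 0 < x) => (hasDerivAt_mul_sub_div s c hx.ne').hasDerivWithinAt)
    (injOn_mul_sub_div_Ioi hs hc) (fun u => Real.exp (-u ^ 2))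
  rw [image_mul_sub_div_Ioi hs hc, integrableOn_univ] at h
  refine (h.1 (by simpa using integrable_exp_neg_mul_sq one_pos)).congr_fun
    (fun x (hx : 0 < x) => ?_) measurableSet_Ioi
  dsimp only
  rw [abs_of_pos (by positivity), smul_eq_mul]

lemma integral_mul_exp_neg_sq_mul_sub_div {s c : ℝ} (hs : 0 < s) (hc : 0 < c) :
    ∫ x in Set.Ioi (0 : ℝ), (s + c / x ^ 2) * Real.exp (-(s * x - c / x) ^ 2) = √Real.pi := by
  have h := integral_image_eq_integral_abs_deriv_smul measurableSet_Ioi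
    (fun x (hx : 0 < x) => (hasDerivAt_mul_sub_div s c hx.ne').hasDerivWithinAt)
    (injOn_mul_sub_div_Ioi hs hc) (fun u => Real.exp (-u ^ 2))
  rw [image_mul_sub_div_Ioi hs hc, setIntegral_univ] at h
  have hg : ∫ u : ℝ, Real.exp (-u ^ 2) = √Real.pi := by simpa using integral_gaussian 1
  rw [← hg, h]
  refine setIntegral_congr_fun measurableSet_Ioi fun x (hx : 0 < x) => ?_
  rw [abs_of_pos (by positivity), smul_eq_mul]

/-- The inversion `x ↦ k / x` of the half-line as a change of variables. -/
lemma integral_Ioi_comp_const_div {k : ℝ} (hk : 0 < k) (f : ℝ → ℝ) :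
    ∫ x in Set.Ioi (0 : ℝ), k / x ^ 2 * f (k / x) = ∫ x in Set.Ioi (0 : ℝ), f x := by
  have himage : (fun x : ℝ => k / x) '' Set.Ioi 0 = Set.Ioi 0 := by
    ext y
    constructor
    · rintro ⟨x, hx, rfl⟩
      exact div_pos hk hx
    · intro hy
      exact ⟨k / y, div_pos hk hy, div_div_cancel₀ hk.ne'⟩
  have hinj : Set.InjOn (fun x : ℝ => k / x) (Set.Ioi 0) := by
    intro x _ y _ hxy
    simpa [div_eq_mul_inv, hk.ne'] using hxy
  have h := integral_image_eq_integral_abs_deriv_smul measurableSet_Ioi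
    (fun x (hx : 0 < x) => (hasDerivAt_const_div k hx.ne').hasDerivWithinAt) hinj f
  rw [himage] at h
  rw [h]
  refine setIntegral_congr_fun measurableSet_Ioi fun x (hx : 0 < x) => ?_
  rw [abs_neg, abs_of_pos (by positivity), smul_eq_mul]

/-- The Cauchy–Schlömilch transformation of the Gaussian integral. -/
lemma integral_exp_neg_sq_mul_sub_div {s c : ℝ} (hs : 0 < s) (hc : 0 < c) :
    ∫ x in Set.Ioi (0 : ℝ), Real.exp (-(s * x - c / x) ^ 2) = √Real.pi / (2 * s) := by
  have hsum := integrableOn_mul_exp_neg_sq_mul_sub_div hs hc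
  have hf : IntegrableOn (fun x : ℝ => s * Real.exp (-(s * x - c / x) ^ 2)) (Set.Ioi 0) := by
    refine Integrable.mono' hsum (Measurable.aestronglyMeasurable (by fun_prop)) ?_
    refine Filter.Eventually.of_forall fun x => ?_
    rw [Real.norm_of_nonneg (by positivity)]
    gcongr
    exact le_add_of_nonneg_right (by positivity)
  have hg : IntegrableOn (fun x : ℝ => c / x ^ 2 * Real.exp (-(s * x - c / x) ^ 2))
      (Set.Ioi 0) := by
    refine (hsum.sub hf).congr (Filter.Eventually.of_forall fun x => ?_)
    simp only [Pi.sub_apply]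
    ring
  have hinv : ∫ x in Set.Ioi (0 : ℝ), c / x ^ 2 * Real.exp (-(s * x - c / x) ^ 2) =
      ∫ x in Set.Ioi (0 : ℝ), s * Real.exp (-(s * x - c / x) ^ 2) := by
    rw [← integral_Ioi_comp_const_div (div_pos hc hs)]
    refine setIntegral_congr_fun measurableSet_Ioi fun x (hx : 0 < x) => ?_
    have h : s * (c / s / x) - c / (c / s / x) = -(s * x - c / x) := by
      field_simp
      ring
    rw [h, neg_sq]
    field_simp
  have h := integral_mul_exp_neg_sq_mul_sub_div hs hc
  simp only [add_mul] at h
  rw [integral_add hf hg, hinv, integral_const_mul] at h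
  rw [eq_div_iff (by positivity)]
  linarith

theorem integral_exp_neg_add_inv_sq (a b : ℝ) (ha : 0 < a) (hb : 0 < b) :
    ∫ x in Set.Ioi (0 : ℝ), Real.exp (-a * x ^ 2 - b / x ^ 2) =
      (1 / 2) * Real.sqrt (Real.pi / a) * Real.exp (-2 * Real.sqrt (a * b)) := by
  have hsquare : ∀ x ∈ Set.Ioi (0 : ℝ), Real.exp (-a * x ^ 2 - b / x ^ 2) =
      Real.exp (-(√a * x - √b / x) ^ 2) * Real.exp (-2 * √(a * b)) := by
    intro x (hx : 0 < x)
    rw [← Real.exp_add, Real.sqrt_mul ha.le]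
    congr 1
    have hsa := Real.sq_sqrt ha.le
    have hsb := Real.sq_sqrt hb.le
    generalize √a = s at *
    generalize √b = c at *
    subst hsa hsb
    field_simp
    ring
  rw [setIntegral_congr_fun measurableSet_Ioi hsquare, integral_mul_const,
    integral_exp_neg_sq_mul_sub_div (Real.sqrt_pos.2 ha) (Real.sqrt_pos.2 hb),
    Real.sqrt_div Real.pi_pos.le]
  ring
end

section
/- For every real number b > 0 and every natural number n ≥ 1, ∫₀^∞ exp(−(x − b/x)^{2n}) dx = Γ(1/(2n)) / (2n); equivalently, the integral of exp(−(x − b/x)^{2n}) over all of ℝ (the integrand being defined for x ≠ 0, which is a set of full measure) equals (1/n)·Γ(1/(2n)). -/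
open MeasureTheory

theorem hasDerivAt_sub_const_div (b : ℝ) {x : ℝ} (hx : x ≠ 0) :
    HasDerivAt (fun x : ℝ => x - b / x) (1 + b / x ^ 2) x := by
  convert! (hasDerivAt_id' x).sub ((hasDerivAt_inv hx).const_mul b) using 1
  ring

theorem monotoneOn_sub_const_div {b : ℝ} (hb : 0 ≤ b) :
    MonotoneOn (fun x : ℝ => x - b / x) (Set.Ioi 0) := by
  intro x hx y _ hxy
  have hx' : 0 < x := hx
  dsimp only
  gcongr

theorem image_sub_const_div_Ioi {b : ℝ} (hb : 0 < b) :
    (fun x : ℝ => x - b / x) '' Set.Ioi 0 = Set.univ := by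
  refine Set.eq_univ_of_forall fun y => ?_
  have hsq : √(y ^ 2 + 4 * b) ^ 2 = y ^ 2 + 4 * b := Real.sq_sqrt (by positivity)
  have hpos : 0 < y + √(y ^ 2 + 4 * b) := by
    have h : |y| < √(y ^ 2 + 4 * b) :=
      Real.lt_sqrt_of_sq_lt (by rw [sq_abs]; linarith)
    linarith [neg_abs_le y]
  refine ⟨(y + √(y ^ 2 + 4 * b)) / 2, half_pos hpos, ?_⟩
  have hne := hpos.ne'
  dsimp only
  field_simp
  linear_combination hsq

theorem image_const_div_Ioi {b : ℝ} (hb : 0 < b) :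
    (fun x : ℝ => b / x) '' Set.Ioi 0 = Set.Ioi 0 := by
  ext y
  constructor
  · rintro ⟨x, hx, rfl⟩
    exact div_pos hb hx
  · exact fun hy => ⟨b / y, div_pos hb hy, div_div_cancel₀ hb.ne'⟩

theorem integral_comp_const_div_Ioi {b : ℝ} (hb : 0 < b) (g : ℝ → ℝ) :
    ∫ x in Set.Ioi (0 : ℝ), g x = ∫ x in Set.Ioi (0 : ℝ), b / x ^ 2 * g (b / x) := by
  have hderiv (x : ℝ) (hx : x ∈ Set.Ioi (0 : ℝ)) :
      HasDerivWithinAt (fun x : ℝ => b / x) (-(b / x ^ 2)) (Set.Ioi 0) x := by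
    have hx' : x ≠ 0 := ne_of_gt hx
    convert! ((hasDerivAt_inv hx').const_mul b).hasDerivWithinAt using 1
    ring
  have hanti : AntitoneOn (fun x : ℝ => b / x) (Set.Ioi 0) := by
    intro x hx y _ hxy
    have hx' : 0 < x := hx
    dsimp only
    gcongr
  have h := integral_image_eq_integral_deriv_smul_of_antitoneOn measurableSet_Ioi hderiv hanti g
  simpa only [image_const_div_Ioi hb, neg_neg, smul_eq_mul] using h

/-- The **Cauchy–Schlömilch transformation**. -/
theorem integral_comp_sub_const_div_Ioi {b : ℝ} (hb : 0 < b) {f : ℝ → ℝ}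
    (hf : Integrable f) (heven : f.Even) :
    ∫ x in Set.Ioi (0 : ℝ), f (x - b / x) = (∫ x, f x) / 2 := by
  have hderiv (x : ℝ) (hx : x ∈ Set.Ioi (0 : ℝ)) :=
    (hasDerivAt_sub_const_div b (ne_of_gt hx)).hasDerivWithinAt (s := Set.Ioi 0)
  have hmono := monotoneOn_sub_const_div hb.le
  have hint := integrableOn_image_iff_integrableOn_deriv_smul_of_monotoneOn
    measurableSet_Ioi hderiv hmono f
  have hcov := integral_image_eq_integral_deriv_smul_of_monotoneOn
    measurableSet_Ioi hderiv hmono f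
  simp only [image_sub_const_div_Ioi hb, integrableOn_univ, setIntegral_univ,
    smul_eq_mul] at hint hcov
  have hweighted := hint.1 hf
  have hcomp : IntegrableOn (fun x => f (x - b / x)) (Set.Ioi 0) := by
    have hmeas : Measurable fun x : ℝ => (1 + b / x ^ 2)⁻¹ := by fun_prop
    refine (hweighted.bdd_mul (c := 1) hmeas.aestronglyMeasurable
      (.of_forall fun x => ?_)).congr (.of_forall fun x => ?_)
    · have h : 0 ≤ b / x ^ 2 := by positivity
      rw [Real.norm_of_nonneg (by positivity)]
      exact inv_le_one_of_one_le₀ (by linarith)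
    · have h : 1 + b / x ^ 2 ≠ 0 := by positivity
      exact inv_mul_cancel_left₀ h _
  have hrefl : ∫ x in Set.Ioi (0 : ℝ), f (x - b / x) =
      ∫ x in Set.Ioi (0 : ℝ), b / x ^ 2 * f (x - b / x) := by
    rw [integral_comp_const_div_Ioi hb]
    congr with x
    rw [div_div_cancel₀ hb.ne', ← heven (x - b / x), neg_sub]
  have hsub := integral_sub hweighted hcomp
  have hsimp (x : ℝ) :
      (1 + b / x ^ 2) * f (x - b / x) - f (x - b / x) = b / x ^ 2 * f (x - b / x) := by ring
  simp only [hsimp] at hsub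
  linarith

theorem integral_exp_neg_pow_two_mul {n : ℕ} (hn : 1 ≤ n) :
    ∫ x : ℝ, Real.exp (-x ^ (2 * n)) = (1 / n) * Real.Gamma (1 / (2 * n)) := by
  have hn' : (0 : ℝ) < n := by exact_mod_cast hn
  have h := integral_exp_neg_rpow (p := ((2 * n : ℕ) : ℝ)) (by push_cast; positivity)
  simp only [Real.rpow_natCast] at h
  have habs := integral_comp_abs (f := fun x => Real.exp (-x ^ (2 * n)))
  simp only [(even_two_mul n).pow_abs] at habs
  rw [habs, h, Real.Gamma_add_one (by positivity)]
  push_cast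
  field_simp

theorem integrable_exp_neg_pow_two_mul {n : ℕ} (hn : 1 ≤ n) :
    Integrable fun x : ℝ => Real.exp (-x ^ (2 * n)) := by
  refine Integrable.of_integral_ne_zero ?_
  have hn' : (0 : ℝ) < n := by exact_mod_cast hn
  rw [integral_exp_neg_pow_two_mul hn]
  have := Real.Gamma_pos_of_pos (s := 1 / (2 * n)) (by positivity)
  positivity

theorem integral_exp_neg_pow_two_n (b : ℝ) (hb : 0 < b) (n : ℕ) (hn : 1 ≤ n) :
    (∫ x in Set.Ioi (0 : ℝ), Real.exp (-(x - b / x) ^ (2 * n)) =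
        Real.Gamma (1 / (2 * n)) / (2 * n)) ∧
      ∫ x : ℝ, Real.exp (-(x - b / x) ^ (2 * n)) =
        (1 / n) * Real.Gamma (1 / (2 * n)) := by
  have hn' : (n : ℝ) ≠ 0 := by positivity
  have hhalf : ∫ x in Set.Ioi (0 : ℝ), Real.exp (-(x - b / x) ^ (2 * n)) =
      Real.Gamma (1 / (2 * n)) / (2 * n) := by
    rw [integral_comp_sub_const_div_Ioi (f := fun x => Real.exp (-x ^ (2 * n))) hb
      (integrable_exp_neg_pow_two_mul hn) fun x => by simp only [(even_two_mul n).neg_pow],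
      integral_exp_neg_pow_two_mul hn]
    field_simp
  refine ⟨hhalf, ?_⟩
  have habs (x : ℝ) : (|x| - b / |x|) ^ (2 * n) = (x - b / x) ^ (2 * n) := by
    rcases abs_choice x with h | h
    · rw [h]
    · rw [h, div_neg, ← (even_two_mul n).neg_pow]
      ring
  have h := integral_comp_abs (f := fun x => Real.exp (-(x - b / x) ^ (2 * n)))
  simp only [habs] at h
  rw [h, hhalf]
  field_simp
end

section
/- Let a > −1, c > 1/2 and b > 0 be real numbers. Define I₁ = ∫₀^∞ (x²/(x⁴+2a·x²+1))^c · ((x²+1)/(x^b+1)) · x⁻² dx, I₂ = ∫₀^∞ (x²/(x⁴+2a·x²+1))^c · x⁻² dx, I₃ = ∫₀^∞ (x²/(x⁴+2a·x²+1))^c dx, and I₄ = (1/2)·∫₀^∞ (x²/(x⁴+2a·x²+1))^c · ((x²+1)/x²) dx. Then I₁ = I₂ = I₃ = I₄, and this common value equals 2^{−1/2−c} · (1+a)^{1/2−c} · B(c − 1/2, 1/2), where B(x,y) = Γ(x)·Γ(y)/Γ(x+y) is Euler's beta function. -/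
open MeasureTheory

/-- The beta integral over the reals. -/
lemma integral_Ioo_rpow_mul_one_sub_rpow {p q : ℝ} (hp : 0 < p) (hq : 0 < q) :
    ∫ s in Set.Ioo (0 : ℝ) 1, s ^ (p - 1) * (1 - s) ^ (q - 1) =
      Real.Gamma p * Real.Gamma q / Real.Gamma (p + q) := by
  have h := Complex.betaIntegral_eq_Gamma_mul_div p q (by simpa) (by simpa)
  rw [Complex.betaIntegral, intervalIntegral.integral_of_le zero_le_one,
    integral_Ioc_eq_integral_Ioo, Complex.Gamma_ofReal, Complex.Gamma_ofReal,
    ← Complex.ofReal_add, Complex.Gamma_ofReal] at h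
  have key : ∫ s in Set.Ioo (0 : ℝ) 1, (s : ℂ) ^ ((p : ℂ) - 1) * (1 - (s : ℂ)) ^ ((q : ℂ) - 1) =
      ∫ s in Set.Ioo (0 : ℝ) 1, ((s ^ (p - 1) * (1 - s) ^ (q - 1) : ℝ) : ℂ) := by
    refine setIntegral_congr_fun measurableSet_Ioo fun s hs => ?_
    have h1 : 0 ≤ 1 - s := by linarith [hs.2]
    push_cast [Complex.ofReal_cpow hs.1.le, Complex.ofReal_cpow h1]
    rfl
  rw [key, integral_complex_ofReal] at h
  exact_mod_cast h

lemma integral_Ioi_sq_add_rpow_neg {m c : ℝ} (hm : 0 < m) (hc : 1 / 2 < c) :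
    ∫ u in Set.Ioi (0 : ℝ), (u ^ 2 + m) ^ (-c) =
      (1 / 2) * m ^ (1 / 2 - c) *
        (Real.Gamma (c - 1 / 2) * Real.Gamma (1 / 2) / Real.Gamma c) := by
  have hpos : ∀ u : ℝ, 0 < u ^ 2 + m := fun u => by positivity
  have hderiv : ∀ u ∈ Set.Ioi (0 : ℝ), HasDerivWithinAt (fun u : ℝ => m / (u ^ 2 + m))
      (-(2 * m * u / (u ^ 2 + m) ^ 2)) (Set.Ioi 0) u := fun u _ => by
    have h := ((hasDerivAt_const u m).div ((hasDerivAt_pow 2 u).add_const m) (hpos u).ne')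
    refine (h.congr_deriv ?_).hasDerivWithinAt
    simp
    ring
  have hanti : AntitoneOn (fun u : ℝ => m / (u ^ 2 + m)) (Set.Ioi 0) := fun u hu v _ huv => by
    have hu' : 0 < u := hu
    have := hpos u
    dsimp only
    gcongr
  have himage : (fun u : ℝ => m / (u ^ 2 + m)) '' Set.Ioi 0 = Set.Ioo 0 1 := by
    ext s
    constructor
    · rintro ⟨u, hu, rfl⟩
      have hu' : 0 < u := hu
      have := hpos u
      refine ⟨by positivity, ?_⟩
      rw [div_lt_one this]
      nlinarith
    · rintro ⟨h0, h1⟩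
      have h2 : 0 < m * (1 - s) / s := by
        have : 0 < 1 - s := by linarith
        positivity
      refine ⟨√(m * (1 - s) / s), Real.sqrt_pos.2 h2, ?_⟩
      dsimp only
      rw [Real.sq_sqrt h2.le]
      field_simp
      ring
  have hbeta := integral_Ioo_rpow_mul_one_sub_rpow (p := c - 1 / 2) (q := 1 / 2)
    (by linarith) (by norm_num)
  rw [← himage, integral_image_eq_integral_deriv_smul_of_antitoneOn measurableSet_Ioi hderiv hanti,
    sub_add_cancel] at hbeta
  rw [← hbeta, ← integral_const_mul]
  refine setIntegral_congr_fun measurableSet_Ioi fun u hu => ?_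
  have hu' : 0 < u := hu
  have hP := hpos u
  have e1 : 1 - m / (u ^ 2 + m) = u ^ 2 / (u ^ 2 + m) := by field_simp; ring
  have e2 : (u ^ 2) ^ (1 / 2 - 1 : ℝ) = u⁻¹ := by
    rw [← Real.rpow_natCast, ← Real.rpow_mul hu'.le, ← Real.rpow_neg_one]
    norm_num
  rw [e1, Real.div_rpow hm.le hP.le, Real.div_rpow (by positivity) hP.le, e2, smul_eq_mul, neg_neg]
  generalize u ^ 2 + m = P at *
  have e3 : m ^ (c - 1 / 2 - 1) = (m ^ (1 / 2 - c))⁻¹ * m⁻¹ := by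
    rw [← Real.rpow_neg hm.le, ← Real.rpow_neg_one m, ← Real.rpow_add hm]
    ring_nf
  have e4 : P ^ (-c) = (P ^ (c - 1 / 2 - 1))⁻¹ * (P ^ (1 / 2 - 1 : ℝ))⁻¹ * (P ^ 2)⁻¹ := by
    rw [← Real.rpow_neg hP.le, ← Real.rpow_neg hP.le, ← Real.rpow_natCast,
      ← Real.rpow_neg hP.le, ← Real.rpow_add hP, ← Real.rpow_add hP]
    congr 1
    push_cast
    ring
  rw [e3, e4]
  have := Real.rpow_pos_of_pos hm (1 / 2 - c)
  have := Real.rpow_pos_of_pos hP (c - 1 / 2 - 1)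
  have := Real.rpow_pos_of_pos hP (1 / 2 - 1)
  field_simp

lemma integral_sq_add_rpow_neg {m c : ℝ} (hm : 0 < m) (hc : 1 / 2 < c) :
    ∫ u : ℝ, (u ^ 2 + m) ^ (-c) =
      m ^ (1 / 2 - c) * (Real.Gamma (c - 1 / 2) * Real.Gamma (1 / 2) / Real.Gamma c) := by
  have h := integral_comp_abs (f := fun u : ℝ => (u ^ 2 + m) ^ (-c))
  simp only [sq_abs] at h
  rw [h, integral_Ioi_sq_add_rpow_neg hm hc]
  ring

/-- The substitution `u = x - x⁻¹`. -/
lemma integral_comp_sub_inv (g : ℝ → ℝ) :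
    ∫ x in Set.Ioi (0 : ℝ), (1 + (x ^ 2)⁻¹) * g (x - x⁻¹) = ∫ u, g u := by
  have hderiv : ∀ x ∈ Set.Ioi (0 : ℝ), HasDerivWithinAt (fun x : ℝ => x - x⁻¹)
      (1 + (x ^ 2)⁻¹) (Set.Ioi 0) x := fun x hx => by
    have h := (hasDerivAt_id x).sub (hasDerivAt_inv (ne_of_gt hx))
    rw [sub_neg_eq_add] at h
    exact h.hasDerivWithinAt
  have hmono : MonotoneOn (fun x : ℝ => x - x⁻¹) (Set.Ioi 0) := fun x hx y _ hxy => by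
    have hx' : 0 < x := hx
    dsimp only
    gcongr
  have himage : (fun x : ℝ => x - x⁻¹) '' Set.Ioi 0 = Set.univ := by
    refine Set.eq_univ_of_forall fun u => ?_
    have h1 : 0 < u ^ 2 + 4 := by positivity
    have h2 := Real.sq_sqrt h1.le
    have h3 : 0 < u + √(u ^ 2 + 4) := by
      have : |u| < √(u ^ 2 + 4) := Real.lt_sqrt_of_sq_lt (by rw [sq_abs]; linarith)
      linarith [neg_abs_le u]
    refine ⟨(u + √(u ^ 2 + 4)) / 2, by simpa using h3, ?_⟩
    dsimp only
    field_simp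
    linarith
  rw [← setIntegral_univ (f := g), ← himage,
    integral_image_eq_integral_deriv_smul_of_monotoneOn measurableSet_Ioi hderiv hmono]
  rfl

/-- The substitution `x ↦ x⁻¹`. -/
lemma integral_Ioi_comp_inv (g : ℝ → ℝ) :
    ∫ x in Set.Ioi (0 : ℝ), (x ^ 2)⁻¹ * g x⁻¹ = ∫ x in Set.Ioi (0 : ℝ), g x := by
  rw [← integral_comp_rpow_Ioi g (p := -1) (by norm_num)]
  refine setIntegral_congr_fun measurableSet_Ioi fun x hx => ?_
  have hx' : 0 < x := hx
  have h : x ^ (-1 - 1 : ℝ) = (x ^ 2)⁻¹ := by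
    rw [← Real.rpow_natCast, ← Real.rpow_neg hx'.le]
    norm_num
  simp [h, Real.rpow_neg_one]

lemma quartic_pos {a x : ℝ} (ha : -1 < a) (hx : 0 < x) : 0 < x ^ 4 + 2 * a * x ^ 2 + 1 := by
  nlinarith [sq_nonneg (x ^ 2 - 1), mul_pos (by linarith : 0 < 1 + a) (pow_pos hx 2)]

lemma weight_eq {a x : ℝ} (c : ℝ) (ha : -1 < a) (hx : 0 < x) :
    (x ^ 2 / (x ^ 4 + 2 * a * x ^ 2 + 1)) ^ c = ((x - x⁻¹) ^ 2 + 2 * (1 + a)) ^ (-c) := by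
  have hq := quartic_pos ha hx
  have h : (x - x⁻¹) ^ 2 + 2 * (1 + a) = (x ^ 2 / (x ^ 4 + 2 * a * x ^ 2 + 1))⁻¹ := by
    field_simp
    ring
  rw [h, Real.rpow_neg (by positivity), Real.inv_rpow (by positivity), inv_inv]

lemma weight_inv {a x : ℝ} (c : ℝ) (ha : -1 < a) (hx : 0 < x) :
    (x⁻¹ ^ 2 / (x⁻¹ ^ 4 + 2 * a * x⁻¹ ^ 2 + 1)) ^ c =
      (x ^ 2 / (x ^ 4 + 2 * a * x ^ 2 + 1)) ^ c := by
  rw [weight_eq c ha hx, weight_eq c ha (inv_pos.2 hx), inv_inv]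
  ring_nf

lemma integral_weight_symmetrized {a c : ℝ} (ha : -1 < a) (hc : 1 / 2 < c) :
    ∫ x in Set.Ioi (0 : ℝ), (x ^ 2 / (x ^ 4 + 2 * a * x ^ 2 + 1)) ^ c * ((x ^ 2 + 1) / x ^ 2) =
      (2 * (1 + a)) ^ (1 / 2 - c) *
        (Real.Gamma (c - 1 / 2) * Real.Gamma (1 / 2) / Real.Gamma c) := by
  rw [← integral_sq_add_rpow_neg (by linarith) hc,
    ← integral_comp_sub_inv fun u => (u ^ 2 + 2 * (1 + a)) ^ (-c)]
  refine setIntegral_congr_fun measurableSet_Ioi fun x hx => ?_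
  have hx' : 0 < x := hx
  rw [weight_eq c ha hx']
  field_simp

lemma integrableOn_weight_symmetrized {a c : ℝ} (ha : -1 < a) (hc : 1 / 2 < c) :
    IntegrableOn (fun x : ℝ => (x ^ 2 / (x ^ 4 + 2 * a * x ^ 2 + 1)) ^ c * ((x ^ 2 + 1) / x ^ 2))
      (Set.Ioi 0) := by
  have h1 := Real.Gamma_pos_of_pos (by linarith : 0 < c - 1 / 2)
  have h2 := Real.Gamma_pos_of_pos (by norm_num : (0 : ℝ) < 1 / 2)
  have h3 := Real.Gamma_pos_of_pos (by linarith : 0 < c)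
  have h4 := Real.rpow_pos_of_pos (by linarith : 0 < 2 * (1 + a)) (1 / 2 - c)
  refine Integrable.of_integral_ne_zero ?_
  rw [integral_weight_symmetrized ha hc]
  positivity

/-- The integral against `1 / (x ^ b + 1)` does not depend on `b`. -/
lemma integral_weight_mul_div_rpow_add_one {a c : ℝ} (b : ℝ) (ha : -1 < a) (hc : 1 / 2 < c) :
    ∫ x in Set.Ioi (0 : ℝ), (x ^ 2 / (x ^ 4 + 2 * a * x ^ 2 + 1)) ^ c *
        ((x ^ 2 + 1) / (x ^ b + 1)) * (x ^ 2)⁻¹ =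
      (1 / 2) * ∫ x in Set.Ioi (0 : ℝ),
        (x ^ 2 / (x ^ 4 + 2 * a * x ^ 2 + 1)) ^ c * ((x ^ 2 + 1) / x ^ 2) := by
  set f : ℝ → ℝ := fun x => (x ^ 2 / (x ^ 4 + 2 * a * x ^ 2 + 1)) ^ c *
    ((x ^ 2 + 1) / (x ^ b + 1)) * (x ^ 2)⁻¹ with hf
  have hadd : ∀ x ∈ Set.Ioi (0 : ℝ), (x ^ 2 / (x ^ 4 + 2 * a * x ^ 2 + 1)) ^ c *
      ((x ^ 2 + 1) / x ^ 2) = f x + (x ^ 2)⁻¹ * f x⁻¹ := fun x hx => by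
    have hx' : 0 < x := hx
    have := Real.rpow_pos_of_pos hx' b
    simp only [hf]
    rw [weight_inv c ha hx', Real.inv_rpow hx'.le]
    field_simp
    ring
  have hnonneg : ∀ x ∈ Set.Ioi (0 : ℝ), 0 ≤ f x := fun x hx => by
    have hx' : 0 < x := hx
    have := quartic_pos ha hx'
    simp only [hf]
    positivity
  have hint := integrableOn_weight_symmetrized ha hc
  have hfint : IntegrableOn f (Set.Ioi 0) := by
    refine hint.mono' (by fun_prop) ?_
    refine (ae_restrict_iff' measurableSet_Ioi).2 (.of_forall fun x hx => ?_)
    have hx' : 0 < x := hx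
    rw [Real.norm_of_nonneg (hnonneg x hx), hadd x hx, le_add_iff_nonneg_right]
    exact mul_nonneg (by positivity) (hnonneg _ (inv_pos.2 hx'))
  have hfint' : IntegrableOn (fun x => (x ^ 2)⁻¹ * f x⁻¹) (Set.Ioi 0) := by
    refine (hint.sub hfint).congr_fun (fun x hx => ?_) measurableSet_Ioi
    simp [hadd x hx]
  rw [setIntegral_congr_fun measurableSet_Ioi hadd, integral_add hfint hfint',
    integral_Ioi_comp_inv f]
  ring

theorem boros_three_param (a b c : ℝ) (ha : -1 < a) (hc : 1 / 2 < c) (hb : 0 < b)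
    (I₁ I₂ I₃ I₄ : ℝ)
    (h1 : I₁ = ∫ x in Set.Ioi (0 : ℝ),
      (x ^ 2 / (x ^ 4 + 2 * a * x ^ 2 + 1)) ^ c * ((x ^ 2 + 1) / (x ^ b + 1)) * (x ^ 2)⁻¹)
    (h2 : I₂ = ∫ x in Set.Ioi (0 : ℝ),
      (x ^ 2 / (x ^ 4 + 2 * a * x ^ 2 + 1)) ^ c * (x ^ 2)⁻¹)
    (h3 : I₃ = ∫ x in Set.Ioi (0 : ℝ),
      (x ^ 2 / (x ^ 4 + 2 * a * x ^ 2 + 1)) ^ c)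
    (h4 : I₄ = (1 / 2) * ∫ x in Set.Ioi (0 : ℝ),
      (x ^ 2 / (x ^ 4 + 2 * a * x ^ 2 + 1)) ^ c * ((x ^ 2 + 1) / x ^ 2)) :
    I₁ = I₂ ∧ I₂ = I₃ ∧ I₃ = I₄ ∧
      I₄ = (2 : ℝ) ^ (-(1 / 2) - c) * (1 + a) ^ (1 / 2 - c) *
        (Real.Gamma (c - 1 / 2) * Real.Gamma (1 / 2) / Real.Gamma c) := by
  have h14 : I₁ = I₄ := by
    rw [h1, h4, integral_weight_mul_div_rpow_add_one b ha hc]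
  have h24 : I₂ = I₄ := by
    rw [h2, h4, ← integral_weight_mul_div_rpow_add_one 2 ha hc]
    refine setIntegral_congr_fun measurableSet_Ioi fun x _ => ?_
    have h : x ^ 2 + 1 ≠ 0 := by positivity
    rw [Real.rpow_two, div_self h, mul_one]
  have h23 : I₂ = I₃ := by
    rw [← integral_Ioi_comp_inv] at h3
    rw [h2, h3]
    refine setIntegral_congr_fun measurableSet_Ioi fun x hx => ?_
    rw [weight_inv c ha hx, mul_comm]
  refine ⟨h14.trans h24.symm, h23, h23.symm.trans h24, ?_⟩
  have hpow : (2 : ℝ) ^ (-(1 / 2) - c) = 1 / 2 * 2 ^ (1 / 2 - c) := by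
    rw [show -(1 / 2) - c = (1 / 2 - c) - 1 by ring, Real.rpow_sub_one two_ne_zero]
    ring
  rw [h4, integral_weight_symmetrized ha hc, Real.mul_rpow zero_le_two (by linarith), hpow]
  ring
end

section
/- Let a and b be real numbers with −1 < b ≤ a, and set k² = (a−b)/(a+1) (so 0 ≤ k² < 1). Then ∫₀^∞ x² / √((x⁴+2a·x²+1)·(x⁴+2b·x²+1)) dx = (1/√(2(a+1))) · K(k), where K(k) = ∫₀^{π/2} dφ / √(1 − k²·sin²φ) is the complete elliptic integral of the first kind. -/
open MeasureTheory

section CauchySchlomilch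

open Set

lemma hasDerivAt_sub_inv {x : ℝ} (hx : x ≠ 0) :
    HasDerivAt (fun y : ℝ => y - y⁻¹) (1 + (x ^ 2)⁻¹) x := by
  have h := (hasDerivAt_id' x).fun_sub (hasDerivAt_inv hx)
  rwa [sub_neg_eq_add] at h

lemma injOn_sub_inv : InjOn (fun y : ℝ => y - y⁻¹) (Ioi 0) := by
  intro x hx y hy h
  rw [mem_Ioi] at hx hy
  field_simp at h
  have : (x - y) * (x * y + 1) = 0 := by linear_combination h
  rcases mul_eq_zero.1 this with h | h
  · linarith
  · nlinarith [mul_pos hx hy]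

lemma image_sub_inv_Ioi : (fun y : ℝ => y - y⁻¹) '' Ioi 0 = univ := by
  refine eq_univ_of_forall fun u => ?_
  have hs : √(u ^ 2 + 4) ^ 2 = u ^ 2 + 4 := Real.sq_sqrt (by positivity)
  have hpos : 0 < u + √(u ^ 2 + 4) := by
    have : |u| < √(u ^ 2 + 4) := Real.lt_sqrt (abs_nonneg u) |>.2 (by rw [sq_abs]; linarith)
    linarith [neg_abs_le u]
  refine ⟨(u + √(u ^ 2 + 4)) / 2, half_pos hpos, ?_⟩
  field_simp
  linear_combination hs

lemma image_inv_Ioi_zero : (fun y : ℝ => y⁻¹) '' Ioi 0 = Ioi 0 := by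
  ext y
  refine ⟨?_, fun hy => ⟨y⁻¹, mem_Ioi.2 (inv_pos.2 hy), inv_inv y⟩⟩
  rintro ⟨x, hx, rfl⟩
  exact inv_pos.2 (mem_Ioi.1 hx)

/-- The Cauchy–Schlömilch substitution for an even integrable function. -/
lemma integral_comp_sub_inv_of_even {f : ℝ → ℝ} (hf : Integrable f) (hc : Continuous f)
    (heven : ∀ x, f (-x) = f x) :
    ∫ x in Ioi (0 : ℝ), f (x - x⁻¹) = ∫ u in Ioi (0 : ℝ), f u := by
  have hd : ∀ x ∈ Ioi (0 : ℝ),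
      HasDerivWithinAt (fun y : ℝ => y - y⁻¹) (1 + (x ^ 2)⁻¹) (Ioi 0) x :=
    fun x hx => (hasDerivAt_sub_inv (ne_of_gt hx)).hasDerivWithinAt
  have hint : IntegrableOn (fun x : ℝ => |1 + (x ^ 2)⁻¹| • f (x - x⁻¹)) (Ioi 0) := by
    refine (integrableOn_image_iff_integrableOn_abs_deriv_smul measurableSet_Ioi hd
      injOn_sub_inv f).1 ?_
    rw [image_sub_inv_Ioi]
    exact hf.integrableOn
  have hmeas : AEStronglyMeasurable (fun x : ℝ => f (x - x⁻¹)) (volume.restrict (Ioi 0)) :=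
    (hc.measurable.comp (measurable_id.sub measurable_inv)).aestronglyMeasurable
  have h1 : IntegrableOn (fun x : ℝ => f (x - x⁻¹)) (Ioi 0) := by
    refine Integrable.mono hint hmeas (Filter.Eventually.of_forall fun x => ?_)
    have h0 : (0 : ℝ) ≤ (x ^ 2)⁻¹ := by positivity
    rw [norm_smul, Real.norm_eq_abs |1 + (x ^ 2)⁻¹|, abs_abs, abs_of_nonneg (by positivity)]
    nlinarith [norm_nonneg (f (x - x⁻¹)), mul_nonneg h0 (norm_nonneg (f (x - x⁻¹)))]
  have habs : ∀ x : ℝ, |1 + (x ^ 2)⁻¹| • f (x - x⁻¹)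
      = f (x - x⁻¹) + (x ^ 2)⁻¹ * f (x - x⁻¹) := by
    intro x
    rw [abs_of_nonneg (by positivity), smul_eq_mul]
    ring
  have h2 : IntegrableOn (fun x : ℝ => (x ^ 2)⁻¹ * f (x - x⁻¹)) (Ioi 0) := by
    refine (hint.sub h1).congr (Filter.Eventually.of_forall fun x => ?_)
    simp only [Pi.sub_apply, habs]
    ring
  have hinv : ∫ x in Ioi (0 : ℝ), f (x - x⁻¹) = ∫ x in Ioi (0 : ℝ), (x ^ 2)⁻¹ * f (x - x⁻¹) := by
    have := integral_image_eq_integral_abs_deriv_smul (measurableSet_Ioi (a := (0 : ℝ)))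
      (fun x hx => (hasDerivAt_inv (ne_of_gt hx)).hasDerivWithinAt) inv_injective.injOn
      (fun x : ℝ => f (x - x⁻¹))
    rw [image_inv_Ioi_zero] at this
    rw [this]
    refine setIntegral_congr_fun measurableSet_Ioi fun x _ => ?_
    have hx : x⁻¹ - x⁻¹⁻¹ = -(x - x⁻¹) := by rw [inv_inv]; ring
    simp only [hx, heven, abs_neg, smul_eq_mul]
    rw [abs_of_nonneg (by positivity)]
  have hall : ∫ u, f u = ∫ x in Ioi (0 : ℝ), |1 + (x ^ 2)⁻¹| • f (x - x⁻¹) := by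
    rw [← integral_image_eq_integral_abs_deriv_smul measurableSet_Ioi hd injOn_sub_inv f,
      image_sub_inv_Ioi, setIntegral_univ]
  have hhalf : ∫ u, f u = 2 * ∫ u in Ioi (0 : ℝ), f u := by
    rw [← integral_comp_abs]
    refine integral_congr_ae (Filter.Eventually.of_forall fun x => ?_)
    rcases abs_choice x with h | h <;> simp only [h, heven]
  simp only [habs] at hall
  rw [integral_add h1 h2, ← hinv] at hall
  linarith

lemma image_mul_tan_Ioo {c : ℝ} (hc : 0 < c) :
    (fun φ => c * Real.tan φ) '' Ioo 0 (Real.pi / 2) = Ioi 0 := by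
  ext u
  constructor
  · rintro ⟨φ, hφ, rfl⟩
    exact mul_pos hc (Real.tan_pos_of_pos_of_lt_pi_div_two hφ.1 hφ.2)
  · intro hu
    refine ⟨Real.arctan (u / c), ⟨Real.arctan_pos.2 (div_pos hu hc),
      Real.arctan_lt_pi_div_two _⟩, ?_⟩
    simp only [Real.tan_arctan]
    field_simp

lemma integrable_inv_sqrt_mul {A B : ℝ} (hA : 0 < A) (hB : 0 < B) :
    Integrable fun u : ℝ => 1 / √((u ^ 2 + A) * (u ^ 2 + B)) := by
  have hm : 0 < min 1 (min A B) := lt_min one_pos (lt_min hA hB)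
  refine (integrable_inv_one_add_sq.const_mul (min 1 (min A B))⁻¹).mono'
    (Measurable.aestronglyMeasurable (by fun_prop)) (Filter.Eventually.of_forall fun u => ?_)
  rw [Real.norm_of_nonneg (by positivity), ← mul_inv, ← one_div]
  refine one_div_le_one_div_of_le (by positivity) (Real.le_sqrt_of_sq_le ?_)
  set m := min 1 (min A B)
  have h1 : m ≤ 1 := min_le_left _ _
  have hmA : m ≤ A := (min_le_right _ _).trans (min_le_left _ _)
  have hmB : m ≤ B := (min_le_right _ _).trans (min_le_right _ _)
  have hu : m * u ^ 2 ≤ u ^ 2 := mul_le_of_le_one_left (sq_nonneg u) h1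
  rw [sq]
  exact mul_le_mul (by linarith) (by linarith) (by positivity) (by positivity)

/-- The substitution `u = √B tan φ` turns the algebraic form into the Legendre form. -/
lemma integral_inv_sqrt_mul_eq_legendre {A B : ℝ} (hA : 0 < A) (hB : 0 < B) :
    ∫ u in Ioi (0 : ℝ), 1 / √((u ^ 2 + A) * (u ^ 2 + B)) =
      (1 / √A) * ∫ φ in Ioo (0 : ℝ) (Real.pi / 2),
        1 / √(1 - (1 - B / A) * Real.sin φ ^ 2) := by
  have hcos : ∀ φ ∈ Ioo (0 : ℝ) (Real.pi / 2), 0 < Real.cos φ := fun φ hφ =>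
    Real.cos_pos_of_mem_Ioo ⟨by linarith [hφ.1, Real.pi_pos], hφ.2⟩
  have hinj : InjOn (fun φ => √B * Real.tan φ) (Ioo 0 (Real.pi / 2)) := by
    intro x hx y hy h
    refine Real.tan_inj_of_lt_of_lt_pi_div_two (by linarith [hx.1, Real.pi_pos]) hx.2
      (by linarith [hy.1, Real.pi_pos]) hy.2 ?_
    exact mul_left_cancel₀ (Real.sqrt_pos.2 hB).ne' h
  rw [← image_mul_tan_Ioo (Real.sqrt_pos.2 hB),
    integral_image_eq_integral_abs_deriv_smul measurableSet_Ioo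
      (fun φ hφ => ((Real.hasDerivAt_tan (hcos φ hφ).ne').const_mul √B).hasDerivWithinAt) hinj,
    ← integral_const_mul]
  refine setIntegral_congr_fun measurableSet_Ioo fun φ hφ => ?_
  have hc := hcos φ hφ
  have hsc := Real.sin_sq_add_cos_sq φ
  have hD : 0 < 1 - (1 - B / A) * Real.sin φ ^ 2 := by
    have : 1 - (1 - B / A) * Real.sin φ ^ 2 = Real.cos φ ^ 2 + B / A * Real.sin φ ^ 2 := by
      linear_combination -hsc
    rw [this]
    positivity
  have key : ((√B * Real.tan φ) ^ 2 + A) * ((√B * Real.tan φ) ^ 2 + B)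
      = (√B / Real.cos φ ^ 2) ^ 2 * (A * (1 - (1 - B / A) * Real.sin φ ^ 2)) := by
    rw [mul_pow, div_pow, Real.sq_sqrt hB.le, Real.tan_eq_sin_div_cos]
    have hs : Real.sin φ ^ 2 = 1 - Real.cos φ ^ 2 := by linarith
    field_simp
    rw [hs]
    ring
  simp only [key, smul_eq_mul]
  rw [Real.sqrt_mul (sq_nonneg _), Real.sqrt_sq (by positivity), Real.sqrt_mul hA.le,
    abs_of_nonneg (by positivity)]
  have := Real.sqrt_pos.2 hA
  have := Real.sqrt_pos.2 hB
  have := Real.sqrt_pos.2 hD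
  field_simp

end CauchySchlomilch

theorem integral_eq_elliptic_K (a b : ℝ) (hb : -1 < b) (hba : b ≤ a) :
    ∫ x in Set.Ioi (0 : ℝ),
        x ^ 2 / Real.sqrt ((x ^ 4 + 2 * a * x ^ 2 + 1) * (x ^ 4 + 2 * b * x ^ 2 + 1)) =
      (1 / Real.sqrt (2 * (a + 1))) *
        ∫ φ in Set.Ioo (0 : ℝ) (Real.pi / 2),
          1 / Real.sqrt (1 - ((a - b) / (a + 1)) * Real.sin φ ^ 2) := by
  have ha : 0 < a + 1 := by linarith
  have hA : 0 < 2 * (a + 1) := by linarith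
  have hB : 0 < 2 * (b + 1) := by linarith
  have hk : (a - b) / (a + 1) = 1 - 2 * (b + 1) / (2 * (a + 1)) := by
    field_simp
    ring
  rw [hk, ← integral_inv_sqrt_mul_eq_legendre hA hB,
    ← integral_comp_sub_inv_of_even (integrable_inv_sqrt_mul hA hB) ?_ (by simp)]
  · refine setIntegral_congr_fun measurableSet_Ioi fun x hx => ?_
    have hx : 0 < x := hx
    have key : (x ^ 4 + 2 * a * x ^ 2 + 1) * (x ^ 4 + 2 * b * x ^ 2 + 1)
        = (x ^ 2) ^ 2 * (((x - x⁻¹) ^ 2 + 2 * (a + 1)) * ((x - x⁻¹) ^ 2 + 2 * (b + 1))) := by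
      field_simp
      ring
    have : 0 < √(((x - x⁻¹) ^ 2 + 2 * (a + 1)) * ((x - x⁻¹) ^ 2 + 2 * (b + 1))) :=
      Real.sqrt_pos.2 (by positivity)
    simp only [key]
    rw [Real.sqrt_mul (sq_nonneg _), Real.sqrt_sq (by positivity)]
    field_simp
  · exact continuous_const.div (by fun_prop) fun u => (Real.sqrt_pos.2 (by positivity)).ne'
end
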